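/- arXiv:math/0405462 — 2 statements merged into one kernel-verified Lean document; each statement's English description precedes it below -/
import Mathlib

section
/- Let φ : G → H be a surjective group homomorphism between groups G and H. Assume that: (1) there is a natural number n and group isomorphisms from the commutator subgroup [G,G] to FreeGroup (Fin n) and from the commutator subgroup [H,H] to FreeGroup (Fin n); and (2) the abelianizations G/[G,G] and H/[H,H] are both infinite cyclic (isomorphic to ℤ). Then φ is injective, hence an isomorphism. -/
namespace FreeGroup

/-- Every nontrivial element of a free group acts nontrivially in some finite permutation
representation, built on the suffixes of a word representing it. -/
instance residuallyFinite (α : Type*) : Group.ResiduallyFinite (FreeGroup α) := by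
  refine Group.residuallyFinite_of_forall_exists_finite_monoidHom fun g hg ↦ ?_
  obtain ⟨L, rfl⟩ := Quot.exists_rep g
  let S : Set (FreeGroup α) := mk '' {l | l <:+ L}
  have : Finite S := ((List.finite_toSet L.tails).subset
    fun l hl ↦ (List.mem_tails l L).mpr hl).image _
  have exists_perm (a : α) :
      ∃ σ : Equiv.Perm S, ∀ x y : S, of a * x = y → σ x = y := by
    let T := {p : S × S // of a * p.1 = p.2}
    obtain ⟨σ, hσ⟩ := Equiv.Perm.exists_extending_pair (fun p : T ↦ p.1.1) (fun p : T ↦ p.1.2)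
      (fun p q h ↦ Subtype.ext <| Prod.ext h <| Subtype.ext <| by
        rw [← p.2, ← q.2]; exact congrArg (fun x : S ↦ of a * (x : FreeGroup α)) h)
      (fun p q h ↦ Subtype.ext <| Prod.ext (Subtype.ext <| mul_left_cancel <| by
        rw [p.2, q.2]; exact congrArg Subtype.val h) h)
    exact ⟨σ, fun x y h ↦ hσ ⟨(x, y), h⟩⟩
  choose σ hσ using exists_perm
  have lift_apply_one (l : List (α × Bool)) (hl : l <:+ L) :
      lift σ (mk l) ⟨1, [], L.nil_suffix, rfl⟩ = ⟨mk l, l, hl, rfl⟩ := by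
    induction l with
    | nil => rfl
    | cons p l ih =>
      have hl' : l <:+ L := (List.suffix_cons p l).trans hl
      have mk_cons : lift σ (mk (p :: l)) = lift σ (mk [p]) * lift σ (mk l) :=
        _root_.map_mul (lift σ) (mk [p]) (mk l)
      rw [mk_cons, Equiv.Perm.mul_apply, ih hl']
      obtain ⟨a, _ | _⟩ := p
      · have : lift σ (mk [(a, false)]) = (σ a)⁻¹ := by simp
        rw [this, Equiv.Perm.inv_eq_iff_eq]
        refine (hσ a _ _ ?_).symm
        change mk [(a, true)] * mk ([(a, false)] ++ l) = mk l
        rw [mul_mk]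
        exact Quot.sound Red.Step.cons_not
      · have : lift σ (mk [(a, true)]) = σ a := by simp
        rw [this]
        exact hσ a _ _ mul_mk
  refine ⟨Equiv.Perm S, inferInstance, inferInstance, lift σ, fun h ↦ hg ?_⟩
  have := lift_apply_one L List.suffix_rfl
  rw [show lift σ (mk L) = 1 from h] at this
  exact (congrArg Subtype.val this).symm

end FreeGroup

/-- There are only finitely many homomorphisms from a finitely generated group to a finite one. -/
theorem MonoidHom.finite_of_fg (G Q : Type*) [Group G] [Group.FG G] [Group Q] [Finite Q] :
    Finite (G →* Q) := by
  obtain ⟨S, hS, hfin⟩ := Group.fg_iff.mp ‹Group.FG G›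
  have := hfin.to_subtype
  refine Finite.of_injective (fun (f : G →* Q) (s : S) ↦ f s) fun f g h ↦ ?_
  exact MonoidHom.eq_of_eqOn_dense hS fun s hs ↦ congrFun h ⟨s, hs⟩

/-- **Malcev's theorem**: finitely generated residually finite groups are Hopfian. -/
theorem Group.ResiduallyFinite.injective_of_surjective {G : Type*} [Group G] [Group.FG G]
    [Group.ResiduallyFinite G] (f : G →* G) (hf : Function.Surjective f) :
    Function.Injective f := by
  refine (injective_iff_map_eq_one f).mpr fun g hg ↦
    Group.eq_one_iff_forall_finiteIndexNormalSubroup g fun N ↦ ?_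
  have : Finite (G ⧸ N.toSubgroup) := Subgroup.finite_quotient_of_finiteIndex
  have := MonoidHom.finite_of_fg G (G ⧸ N.toSubgroup)
  have comp_injective : Function.Injective fun k : G →* G ⧸ N.toSubgroup ↦ k.comp f :=
    fun _ _ h ↦ (MonoidHom.cancel_right hf).mp h
  obtain ⟨k, hk⟩ := Finite.surjective_of_injective comp_injective (QuotientGroup.mk' N.toSubgroup)
  have : QuotientGroup.mk' N.toSubgroup g = 1 := by
    rw [← hk, MonoidHom.comp_apply, hg, map_one]
  exact (QuotientGroup.eq_one_iff g).mp this

/-- A surjection between free groups of the same finite rank is injective. -/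
theorem FreeGroup.injective_of_surjective_of_mulEquiv {α A B : Type*} [Finite α] [Group A]
    [Group B] (eA : A ≃* FreeGroup α) (eB : B ≃* FreeGroup α) (f : A →* B)
    (hf : Function.Surjective f) : Function.Injective f := by
  have : Group.FG (FreeGroup α) :=
    Group.fg_iff.mpr ⟨_, FreeGroup.closure_range_of α, Set.finite_range _⟩
  have h : Function.Injective (eB ∘ f ∘ eA.symm) :=
    Group.ResiduallyFinite.injective_of_surjective
      (eB.toMonoidHom.comp (f.comp eA.symm.toMonoidHom))
      (eB.surjective.comp (hf.comp eA.symm.surjective))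
  rwa [EquivLike.comp_injective, EquivLike.injective_comp eA.symm] at h


/-- If `φ : G →* H` is surjective, the commutator subgroups of `G` and `H` are both
isomorphic to the free group on `n` generators, and the abelianizations of `G` and `H`
are both infinite cyclic, then `φ` is injective (hence an isomorphism). -/
theorem surjective_injective_of_free_commutator_and_infinite_cyclic_abelianization
    {G H : Type*} [Group G] [Group H] (φ : G →* H) (hφ : Function.Surjective φ)
    (n : ℕ)
    (hG : Nonempty ((commutator G) ≃* FreeGroup (Fin n)))
    (hH : Nonempty ((commutator H) ≃* FreeGroup (Fin n)))
    (haG : Nonempty (Abelianization G ≃* Multiplicative ℤ))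
    (haH : Nonempty (Abelianization H ≃* Multiplicative ℤ)) :
    Function.Injective φ := by
  obtain ⟨eG⟩ := hG
  obtain ⟨eH⟩ := hH
  obtain ⟨aG⟩ := haG
  obtain ⟨aH⟩ := haH
  have map_commutator : (commutator G).map φ = commutator H := by
    rw [commutator_def, commutator_def, Subgroup.map_commutator,
      Subgroup.map_top_of_surjective φ hφ]
  have abelianization_injective : Function.Injective (Abelianization.map φ) := by
    refine FreeGroup.injective_of_surjective_of_mulEquiv
      (aG.trans (FreeGroup.mulEquivIntOfUnique (α := Unit)).symm)
      (aH.trans FreeGroup.mulEquivIntOfUnique.symm) _ fun y ↦ ?_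
    obtain ⟨h, rfl⟩ := QuotientGroup.mk_surjective y
    obtain ⟨g, rfl⟩ := hφ h
    exact ⟨Abelianization.of g, Abelianization.map_of φ g⟩
  have commutator_injective : Function.Injective (φ.subgroupMap (commutator G)) :=
    FreeGroup.injective_of_surjective_of_mulEquiv eG
      ((MulEquiv.subgroupCongr map_commutator).trans eH) _ (φ.subgroupMap_surjective _)
  refine (injective_iff_map_eq_one φ).mpr fun g hg ↦ ?_
  have g_mem : g ∈ commutator G := by
    have : Abelianization.of g = 1 := (map_eq_one_iff _ abelianization_injective).mp <| by
      rw [Abelianization.map_of, hg, map_one]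
    exact (QuotientGroup.eq_one_iff g).mp this
  have : (⟨g, g_mem⟩ : commutator G) = 1 := commutator_injective <| Subtype.ext <| by
    simpa using hg
  exact congrArg Subtype.val this
end

section
/- Let q ≥ 2 be a natural number. The presented group ⟨x, y, z, w ∣ zx = yz, yw = zy, wx = zw, x⁻ᑫ·y·xᑫ = y⟩ (the quotient of the free group on four generators by the normal closure of the relators z·x·z⁻¹·y⁻¹, y·w·y⁻¹·z⁻¹, w·x·w⁻¹·z⁻¹, x⁻ᑫ·y·xᑫ·y⁻¹) is isomorphic to the presented group ⟨x, y ∣ x⁻¹·y⁻¹·x·y⁻¹·x⁻¹·y·x·y⁻¹·x·y, x⁻ᑫ·y·xᑫ·y⁻¹⟩ (the quotient of the free group on two generators by the normal closure of those two relators), under an isomorphism carrying x to x and y to y. -/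
/-- The Wirtinger relations `zx = yz`, `yw = zy`, `wx = zw` of the figure eight knot express the
generator `w` through `x` and `y`. -/
lemma figureEight_w_eq {G : Type*} [Group G] {x y z w : G}
    (h₁ : z * x * z⁻¹ * y⁻¹ = 1) (h₂ : y * w * y⁻¹ * z⁻¹ = 1) (h₃ : w * x * w⁻¹ * z⁻¹ = 1) :
    w = x⁻¹ * y * x := by
  have e₁ : z * x = y * z := by rwa [mul_inv_eq_one, mul_inv_eq_iff_eq_mul] at h₁
  have e₂ : y * w = z * y := by rwa [mul_inv_eq_one, mul_inv_eq_iff_eq_mul] at h₂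
  have e₃ : w * x * w⁻¹ = z := by rwa [mul_inv_eq_one] at h₃
  have e : z * x = z * (y * x * w⁻¹) := by
    calc z * x = y * w * (x * w⁻¹) := by rw [e₁, ← e₃]; group
      _ = z * (y * x * w⁻¹) := by rw [e₂]; group
  rw [mul_assoc, eq_inv_mul_iff_mul_eq, ← eq_mul_inv_iff_mul_eq.mp (mul_left_cancel e)]

/-- The Wirtinger relations of the figure eight knot express the generator `z` through `x`
and `y`. -/
lemma figureEight_z_eq {G : Type*} [Group G] {x y z w : G}
    (h₁ : z * x * z⁻¹ * y⁻¹ = 1) (h₂ : y * w * y⁻¹ * z⁻¹ = 1) (h₃ : w * x * w⁻¹ * z⁻¹ = 1) :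
    z = y * x⁻¹ * y * x * y⁻¹ := by
  rw [← mul_inv_eq_one.mp h₂, figureEight_w_eq h₁ h₂ h₃]
  group

lemma figureEight_wirtinger_zx {G : Type*} [Group G] {x y : G}
    (h : x⁻¹ * y⁻¹ * x * y⁻¹ * x⁻¹ * y * x * y⁻¹ * x * y = 1) :
    (y * x⁻¹ * y * x * y⁻¹) * x * (y * x⁻¹ * y * x * y⁻¹)⁻¹ * y⁻¹ = 1 := by
  rw [← conj_eq_one_iff (a := y * x⁻¹ * y * x * y⁻¹ * x * y)] at h
  rw [← h]
  group

lemma figureEight_wirtinger_wx {G : Type*} [Group G] {x y : G}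
    (h : x⁻¹ * y⁻¹ * x * y⁻¹ * x⁻¹ * y * x * y⁻¹ * x * y = 1) :
    (x⁻¹ * y * x) * x * (x⁻¹ * y * x)⁻¹ * (y * x⁻¹ * y * x * y⁻¹)⁻¹ = 1 := by
  rw [← conj_eq_one_iff (a := x⁻¹ * y * x * y⁻¹ * x * y)] at h
  rw [← h]
  group

/-- The Wirtinger relations of the figure eight knot imply its two-generator relation. -/
lemma figureEight_relator_eq_one {G : Type*} [Group G] {x y z w : G}
    (h₁ : z * x * z⁻¹ * y⁻¹ = 1) (h₂ : y * w * y⁻¹ * z⁻¹ = 1) (h₃ : w * x * w⁻¹ * z⁻¹ = 1) :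
    x⁻¹ * y⁻¹ * x * y⁻¹ * x⁻¹ * y * x * y⁻¹ * x * y = 1 := by
  have hw := figureEight_w_eq h₁ h₂ h₃
  have hz := figureEight_z_eq h₁ h₂ h₃
  rw [hw, hz] at h₃
  rw [← conj_eq_one_iff (a := x⁻¹ * y * x * y⁻¹ * x * y), ← h₃]
  group


/-- For `q ≥ 2`, the presented group
`⟨x, y, z, w ∣ zx = yz, yw = zy, wx = zw, x⁻ᑫ·y·xᑫ = y⟩` is isomorphic to the
two-generator presented group
`⟨x, y ∣ x⁻¹·y⁻¹·x·y⁻¹·x⁻¹·y·x·y⁻¹·x·y, x⁻ᑫ·y·xᑫ·y⁻¹⟩`, by an isomorphism carrying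
`x` to `x` and `y` to `y`. This is the group `π k_q` of the virtual knot `k_q`
of Example 3.12. -/
theorem virtual_knot_group_presentation
    (q : ℕ) (hq : 2 ≤ q)
    (x y z w : FreeGroup (Fin 4))
    (hx : x = FreeGroup.of 0) (hy : y = FreeGroup.of 1)
    (hz : z = FreeGroup.of 2) (hw : w = FreeGroup.of 3)
    (x' y' : FreeGroup (Fin 2))
    (hx' : x' = FreeGroup.of 0) (hy' : y' = FreeGroup.of 1)
    (rels₁ : Set (FreeGroup (Fin 4)))
    (hrels₁ : rels₁ = {z * x * z⁻¹ * y⁻¹, y * w * y⁻¹ * z⁻¹, w * x * w⁻¹ * z⁻¹,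
      (x ^ q)⁻¹ * y * x ^ q * y⁻¹})
    (rels₂ : Set (FreeGroup (Fin 2)))
    (hrels₂ : rels₂ = {x'⁻¹ * y'⁻¹ * x' * y'⁻¹ * x'⁻¹ * y' * x' * y'⁻¹ * x' * y',
      (x' ^ q)⁻¹ * y' * x' ^ q * y'⁻¹}) :
    ∃ e : PresentedGroup rels₁ ≃* PresentedGroup rels₂,
      e (PresentedGroup.of 0) = PresentedGroup.of 0 ∧
      e (PresentedGroup.of 1) = PresentedGroup.of 1 := by
  subst hx hy hz hw hx' hy'
  let X₁ : PresentedGroup rels₁ := PresentedGroup.of 0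
  let Y₁ : PresentedGroup rels₁ := PresentedGroup.of 1
  let Z₁ : PresentedGroup rels₁ := PresentedGroup.of 2
  let W₁ : PresentedGroup rels₁ := PresentedGroup.of 3
  let X₂ : PresentedGroup rels₂ := PresentedGroup.of 0
  let Y₂ : PresentedGroup rels₂ := PresentedGroup.of 1
  have h₁ : Z₁ * X₁ * Z₁⁻¹ * Y₁⁻¹ = 1 :=
    PresentedGroup.one_of_mem (by rw [hrels₁]; simp)
  have h₂ : Y₁ * W₁ * Y₁⁻¹ * Z₁⁻¹ = 1 :=
    PresentedGroup.one_of_mem (by rw [hrels₁]; simp)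
  have h₃ : W₁ * X₁ * W₁⁻¹ * Z₁⁻¹ = 1 :=
    PresentedGroup.one_of_mem (by rw [hrels₁]; simp)
  have h₄ : (X₁ ^ q)⁻¹ * Y₁ * X₁ ^ q * Y₁⁻¹ = 1 :=
    PresentedGroup.one_of_mem (by rw [hrels₁]; simp)
  have k₁ : X₂⁻¹ * Y₂⁻¹ * X₂ * Y₂⁻¹ * X₂⁻¹ * Y₂ * X₂ * Y₂⁻¹ * X₂ * Y₂ = 1 :=
    PresentedGroup.one_of_mem (by rw [hrels₂]; simp)
  have k₂ : (X₂ ^ q)⁻¹ * Y₂ * X₂ ^ q * Y₂⁻¹ = 1 :=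
    PresentedGroup.one_of_mem (by rw [hrels₂]; simp)
  let f : Fin 4 → PresentedGroup rels₂ :=
    ![X₂, Y₂, Y₂ * X₂⁻¹ * Y₂ * X₂ * Y₂⁻¹, X₂⁻¹ * Y₂ * X₂]
  let g : Fin 2 → PresentedGroup rels₁ := ![X₁, Y₁]
  have hf : ∀ r ∈ rels₁, FreeGroup.lift f r = 1 := by
    rw [hrels₁]
    rintro r (rfl | rfl | rfl | rfl) <;> simp only [map_mul, map_inv, map_pow, FreeGroup.lift_apply_of]
    · exact figureEight_wirtinger_zx k₁
    · change Y₂ * (X₂⁻¹ * Y₂ * X₂) * Y₂⁻¹ * (Y₂ * X₂⁻¹ * Y₂ * X₂ * Y₂⁻¹)⁻¹ = 1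
      group
    · exact figureEight_wirtinger_wx k₁
    · exact k₂
  have hg : ∀ r ∈ rels₂, FreeGroup.lift g r = 1 := by
    rw [hrels₂]
    rintro r (rfl | rfl) <;> simp only [map_mul, map_inv, map_pow, FreeGroup.lift_apply_of]
    · exact figureEight_relator_eq_one h₁ h₂ h₃
    · exact h₄
  let F := PresentedGroup.toGroup hf
  let E := PresentedGroup.toGroup hg
  have F_of (i : Fin 4) : F (PresentedGroup.of i) = f i := PresentedGroup.toGroup.of hf
  have E_X : E X₂ = X₁ := PresentedGroup.toGroup.of hg
  have E_Y : E Y₂ = Y₁ := PresentedGroup.toGroup.of hg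
  refine ⟨F.toMulEquiv E ?_ ?_, F_of 0, F_of 1⟩
  · ext i
    rw [MonoidHom.comp_apply, F_of, MonoidHom.id_apply]
    fin_cases i
    · exact E_X
    · exact E_Y
    · change E (Y₂ * X₂⁻¹ * Y₂ * X₂ * Y₂⁻¹) = Z₁
      simp only [map_mul, map_inv, E_X, E_Y]
      exact (figureEight_z_eq h₁ h₂ h₃).symm
    · change E (X₂⁻¹ * Y₂ * X₂) = W₁
      simp only [map_mul, map_inv, E_X, E_Y]
      exact (figureEight_w_eq h₁ h₂ h₃).symm
  · ext i
    rw [MonoidHom.comp_apply, MonoidHom.id_apply]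
    fin_cases i
    · exact (congrArg F E_X).trans (F_of 0)
    · exact (congrArg F E_Y).trans (F_of 1)
end
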